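/- Let Γ be a countable group and suppose the left translation action of Γ on ℓ²(Γ; ℂ), given by (γ·G)(δ) = G(γ⁻¹δ), is algebraically amenable. Then Γ admits an invariant mean: there exists a linear functional m : ℓ^∞(Γ; ℂ) → ℂ with |m(f)| ≤ ‖f‖_∞ for all f, m(1) = 1, and m(γ·f) = m(f) for every γ ∈ Γ and f ∈ ℓ^∞(Γ; ℂ), where (γ·f)(δ) = f(γ⁻¹δ). -/

import Mathlib

open scoped ENNReal

/-- A linear action `ρ` of a group `Γ` on a complex vector space `V` is *algebraically
amenable* if for every finite list `g₁, …, g_m` of elements of `Γ` and every `ε > 0`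
there is a nonzero finite-dimensional subspace `W ⊆ V` with
`dim_ℂ (g₁W + ⋯ + g_mW) < (1 + ε) · dim_ℂ W`. -/
def AlgebraicallyAmenableAction {Γ V : Type*} [Group Γ] [AddCommGroup V] [Module ℂ V]
    (ρ : Γ → (V →ₗ[ℂ] V)) : Prop :=
  ∀ (m : ℕ) (g : Fin m → Γ) (ε : ℝ), 0 < ε →
    ∃ W : Submodule ℂ V, W ≠ ⊥ ∧ FiniteDimensional ℂ W ∧
      (Module.finrank ℂ ↥(⨆ i, W.map (ρ (g i))) : ℝ) <
        (1 + ε) * (Module.finrank ℂ W : ℝ)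

/-- The left translation operator `(γ · G)(δ) = G(γ⁻¹δ)` on `ℓ²(Γ; ℂ)`, as a
`ℂ`-linear map. -/
noncomputable def lpTranslate {Γ : Type*} [Group Γ] (γ : Γ) :
    lp (fun _ : Γ => ℂ) 2 →ₗ[ℂ] lp (fun _ : Γ => ℂ) 2 where
  toFun f := ⟨fun δ => f (γ⁻¹ * δ), by
    have hf : Memℓp (⇑f) 2 := lp.memℓp f
    rw [memℓp_gen_iff (by norm_num)] at hf
    exact (memℓp_gen_iff (by norm_num)).2
      (((Equiv.mulLeft γ⁻¹).summable_iff
        (f := fun δ : Γ => ‖f δ‖ ^ (2 : ℝ≥0∞).toReal)).2 hf)⟩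
  map_add' f g := by
    ext δ
    simp only [lp.coeFn_add, Pi.add_apply]
  map_smul' c f := by
    ext δ
    simp only [lp.coeFn_smul, Pi.smul_apply, RingHom.id_apply]

open Filter Topology

/-- Averages against probability weights on `Γ` converge along an ultrafilter to a mean on
`ℓ^∞(Γ; ℂ)`. -/
theorem exists_ultralimit_mean {Γ ι : Type*} (u : Ultrafilter ι) (φ : ι → Γ → ℝ)
    (hφ : ∀ i δ, 0 ≤ φ i δ) (hsum : ∀ i, HasSum (φ i) 1) :
    ∃ m : lp (fun _ : Γ => ℂ) ∞ →ₗ[ℂ] ℂ,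
      (∀ f : lp (fun _ : Γ => ℂ) ∞, ‖m f‖ ≤ ‖f‖) ∧ m 1 = 1 ∧
      ∀ f, Tendsto (fun i => ∑' δ, (φ i δ : ℂ) * f δ) u (𝓝 (m f)) := by
  have hle (i : ι) (f : lp (fun _ : Γ => ℂ) ∞) (δ : Γ) : ‖(φ i δ : ℂ) * f δ‖ ≤ φ i δ * ‖f‖ := by
    rw [norm_mul, Complex.norm_real, Real.norm_of_nonneg (hφ i δ)]
    exact mul_le_mul_of_nonneg_left (lp.norm_apply_le_norm ENNReal.top_ne_zero f δ) (hφ i δ)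
  have hs (i : ι) (f : lp (fun _ : Γ => ℂ) ∞) : Summable fun δ => (φ i δ : ℂ) * f δ :=
    .of_norm_bounded ((hsum i).summable.mul_right ‖f‖) (hle i f)
  have hnorm (i : ι) (f : lp (fun _ : Γ => ℂ) ∞) : ‖∑' δ, (φ i δ : ℂ) * f δ‖ ≤ ‖f‖ := by
    simpa using tsum_of_norm_bounded ((hsum i).mul_right ‖f‖) (hle i f)
  have hlim (f : lp (fun _ : Γ => ℂ) ∞) : ∃ z ∈ Metric.closedBall (0 : ℂ) ‖f‖,
      Tendsto (fun i => ∑' δ, (φ i δ : ℂ) * f δ) u (𝓝 z) :=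
    (isCompact_closedBall (0 : ℂ) ‖f‖).ultrafilter_le_nhds
      (u.map fun i => ∑' δ, (φ i δ : ℂ) * f δ)
      (tendsto_principal.2 (Eventually.of_forall fun i => by simpa using hnorm i f))
  choose m hm hlim using hlim
  refine ⟨{ toFun := m, map_add' := fun f g => ?_, map_smul' := fun c f => ?_ },
    fun f => by simpa using hm f, ?_, hlim⟩
  · refine tendsto_nhds_unique (hlim _) (((hlim f).add (hlim g)).congr fun i => ?_)
    simp only [lp.coeFn_add, Pi.add_apply, mul_add]
    exact ((hs i f).tsum_add (hs i g)).symm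
  · refine tendsto_nhds_unique (hlim _) (((hlim f).const_mul c).congr fun i => ?_)
    simp only [lp.coeFn_smul, Pi.smul_apply, smul_eq_mul, mul_left_comm _ c, tsum_mul_left]
  · refine tendsto_nhds_unique (hlim 1) (tendsto_const_nhds.congr fun i => ?_)
    simp only [lp.infty_coeFn_one, Pi.one_apply, mul_one]
    exact_mod_cast (hsum i).tsum_eq.symm

/-- Reiter's condition yields an invariant mean. -/
theorem exists_invariant_mean_of_reiter {Γ : Type*} [Group Γ]
    (h : ∀ (S : Finset Γ) (ε : ℝ), 0 < ε → ∃ φ : Γ → ℝ, (∀ δ, 0 ≤ φ δ) ∧ HasSum φ 1 ∧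
      ∀ γ ∈ S, ∑' δ, |φ (γ * δ) - φ δ| ≤ ε) :
    ∃ m : lp (fun _ : Γ => ℂ) ∞ →ₗ[ℂ] ℂ,
      (∀ f : lp (fun _ : Γ => ℂ) ∞, ‖m f‖ ≤ ‖f‖) ∧ m 1 = 1 ∧
      ∀ (γ : Γ) (f f' : lp (fun _ : Γ => ℂ) ∞),
        (∀ δ : Γ, f' δ = f (γ⁻¹ * δ)) → m f' = m f := by
  classical
  choose φ hφ hsum hinv using fun i : Finset Γ × ℕ =>
    h i.1 (1 / ((i.2 : ℝ) + 1)) Nat.one_div_pos_of_nat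
  let u : Ultrafilter (Finset Γ × ℕ) := Ultrafilter.of atTop
  have hu : (u : Filter (Finset Γ × ℕ)) ≤ atTop := Ultrafilter.of_le _
  obtain ⟨m, hm, hm1, hlim⟩ := exists_ultralimit_mean u φ hφ hsum
  refine ⟨m, hm, hm1, fun γ f f' hf => ?_⟩
  have hshift (i : Finset Γ × ℕ) : Summable fun δ => φ i (γ * δ) :=
    (Equiv.mulLeft γ).summable_iff.2 (hsum i).summable
  have hbound (g : lp (fun _ : Γ => ℂ) ∞) {ψ : Γ → ℝ} (hψ : Summable ψ) (δ : Γ) :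
      ‖(ψ δ : ℂ) * g δ‖ ≤ |ψ δ| * ‖g‖ := by
    rw [norm_mul, Complex.norm_real, Real.norm_eq_abs]
    exact mul_le_mul_of_nonneg_left (lp.norm_apply_le_norm ENNReal.top_ne_zero g δ) (abs_nonneg _)
  have hs (g : lp (fun _ : Γ => ℂ) ∞) {ψ : Γ → ℝ} (hψ : Summable ψ) :
      Summable fun δ => (ψ δ : ℂ) * g δ :=
    .of_norm_bounded (hψ.abs.mul_right ‖g‖) (hbound g hψ)
  have hdiff (i : Finset Γ × ℕ) :
      ‖(∑' δ, (φ i δ : ℂ) * f' δ) - ∑' δ, (φ i δ : ℂ) * f δ‖ ≤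
        (∑' δ, |φ i (γ * δ) - φ i δ|) * ‖f‖ := by
    have hd : Summable fun δ => φ i (γ * δ) - φ i δ := (hshift i).sub (hsum i).summable
    rw [← (Equiv.mulLeft γ).tsum_eq fun δ => (φ i δ : ℂ) * f' δ]
    simp only [Equiv.coe_mulLeft, hf, inv_mul_cancel_left]
    rw [← (hs f (hshift i)).tsum_sub (hs f (hsum i).summable)]
    refine tsum_of_norm_bounded (hd.abs.hasSum.mul_right ‖f‖) fun δ => ?_
    simpa [sub_mul] using hbound f hd δ
  refine sub_eq_zero.1 (tendsto_nhds_unique ((hlim f').sub (hlim f)) ?_)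
  have hzero : Tendsto (fun i : Finset Γ × ℕ => 1 / ((i.2 : ℝ) + 1) * ‖f‖) u (𝓝 0) := by
    have := (tendsto_one_div_add_atTop_nhds_zero_nat (𝕜 := ℝ)).comp
      (tendsto_snd.mono_left (prod_atTop_atTop_eq (α := Finset Γ) (β := ℕ)).ge)
    simpa using (this.mono_left hu).mul_const ‖f‖
  refine squeeze_zero_norm' ?_ hzero
  filter_upwards [hu (eventually_ge_atTop ({γ}, 0))] with i hi
  exact (hdiff i).trans (mul_le_mul_of_nonneg_right
    (hinv i γ (hi.1 (Finset.mem_singleton_self γ))) (norm_nonneg f))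

/-- Left translation on `ℓ²(Γ; ℂ)` as a linear isometric equivalence. -/
noncomputable def lpTranslateEquiv {Γ : Type*} [Group Γ] (γ : Γ) :
    lp (fun _ : Γ => ℂ) 2 ≃ₗᵢ[ℂ] lp (fun _ : Γ => ℂ) 2 where
  toLinearEquiv := .ofLinearMap (lpTranslate γ) (lpTranslate γ⁻¹)
    (by ext f δ; simp [lpTranslate]) (by ext f δ; simp [lpTranslate])
  norm_map' f := by
    have h2 : 0 < (2 : ℝ≥0∞).toReal := by norm_num
    rw [lp.norm_eq_tsum_rpow h2, lp.norm_eq_tsum_rpow h2]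
    congr 1
    exact (Equiv.mulLeft γ⁻¹).tsum_eq fun δ => ‖f δ‖ ^ (2 : ℝ≥0∞).toReal

open Classical in
/-- The diagonal matrix coefficient at `δ` of the orthogonal projection onto a finite-dimensional
subspace of `ℓ²(Γ; ℂ)`. -/
noncomputable def projectionDiagonal {Γ : Type*} (W : Submodule ℂ (lp (fun _ : Γ => ℂ) 2))
    [FiniteDimensional ℂ W] (δ : Γ) : ℝ :=
  ‖W.starProjection (lp.single 2 δ (1 : ℂ))‖ ^ 2

section projectionDiagonal

variable {Γ : Type*} (W : Submodule ℂ (lp (fun _ : Γ => ℂ) 2)) [FiniteDimensional ℂ W]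

theorem projectionDiagonal_nonneg (δ : Γ) : 0 ≤ projectionDiagonal W δ :=
  sq_nonneg _

theorem projectionDiagonal_mono {W U : Submodule ℂ (lp (fun _ : Γ => ℂ) 2)}
    [FiniteDimensional ℂ W] [FiniteDimensional ℂ U] (h : W ≤ U) (δ : Γ) :
    projectionDiagonal W δ ≤ projectionDiagonal U δ := by
  refine pow_le_pow_left₀ (norm_nonneg _) ?_ 2
  rw [← Submodule.starProjection_comp_starProjection_of_le h]
  exact W.norm_starProjection_apply_le _

theorem hasSum_projectionDiagonal :
    HasSum (projectionDiagonal W) (Module.finrank ℂ W : ℝ) := by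
  classical
  let b := stdOrthonormalBasis ℂ W
  have hdiag (δ : Γ) :
      projectionDiagonal W δ = ∑ i, ‖(b i : lp (fun _ : Γ => ℂ) 2) δ‖ ^ 2 := by
    rw [projectionDiagonal, W.starProjection_apply, ← Submodule.coe_norm,
      ← b.sum_sq_norm_inner_right]
    refine Finset.sum_congr rfl fun i _ => ?_
    rw [Submodule.inner_orthogonalProjectionOnto_eq_of_mem_left, lp.inner_single_right]
    simp
  have hb (i) : HasSum (fun δ => ‖(b i : lp (fun _ : Γ => ℂ) 2) δ‖ ^ 2) 1 := by
    have h1 : ‖(b i : lp (fun _ : Γ => ℂ) 2)‖ = 1 := b.orthonormal.1 i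
    simpa [h1] using lp.hasSum_norm (p := 2) (by norm_num) (b i : lp (fun _ : Γ => ℂ) 2)
  rw [funext hdiag]
  simpa using hasSum_sum fun i (_ : i ∈ Finset.univ) => hb i

theorem projectionDiagonal_map_lpTranslate [Group Γ] (γ δ : Γ) :
    projectionDiagonal (W.map (lpTranslate γ)) δ = projectionDiagonal W (γ⁻¹ * δ) := by
  classical
  have h := Submodule.starProjection_map_apply (lpTranslateEquiv γ) W (lp.single 2 δ (1 : ℂ))
  have hsymm : (lpTranslateEquiv γ).symm (lp.single 2 δ (1 : ℂ)) =
      lp.single 2 (γ⁻¹ * δ) (1 : ℂ) := by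
    ext x
    change (lp.single 2 δ (1 : ℂ) : lp (fun _ : Γ => ℂ) 2) (γ⁻¹⁻¹ * x) = _
    simp [Pi.single_apply, eq_inv_mul_iff_mul_eq]
  rw [hsymm] at h
  have h' := congrArg (fun x => ‖x‖ ^ 2) h
  simp only [LinearIsometryEquiv.norm_map] at h'
  unfold projectionDiagonal
  convert! h'

end projectionDiagonal

/-- If the left translation action of a countable group `Γ` on `ℓ²(Γ; ℂ)` is
algebraically amenable, then `Γ` admits an invariant mean on `ℓ^∞(Γ; ℂ)`: a
norm-bounded linear functional `m` with `m(1) = 1` which is invariant under left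
translation, `m(γ·f) = m(f)` where `(γ·f)(δ) = f(γ⁻¹δ)`. -/
theorem invariant_mean_of_translation_action_algebraically_amenable (Γ : Type*) [Group Γ]
    [Countable Γ]
    (h : AlgebraicallyAmenableAction (fun γ : Γ => lpTranslate γ)) :
    ∃ m : lp (fun _ : Γ => ℂ) ∞ →ₗ[ℂ] ℂ,
      (∀ f : lp (fun _ : Γ => ℂ) ∞, ‖m f‖ ≤ ‖f‖) ∧
      m 1 = 1 ∧
      ∀ (γ : Γ) (f f' : lp (fun _ : Γ => ℂ) ∞),
        (∀ δ : Γ, f' δ = f (γ⁻¹ * δ)) → m f' = m f := by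
  classical
  refine exists_invariant_mean_of_reiter fun S ε hε => ?_
  let T : Finset Γ := insert 1 (S.image (·⁻¹))
  obtain ⟨W, hW, hfin, hlt⟩ := h T.card (fun i => T.equivFin.symm i) (ε / 2) (half_pos hε)
  set U : Submodule ℂ (lp (fun _ : Γ => ℂ) 2) :=
    ⨆ i, W.map (lpTranslate (T.equivFin.symm i : Γ)) with hU
  have hle {γ : Γ} (hγ : γ ∈ T) : W.map (lpTranslate γ) ≤ U := by
    simpa using le_iSup (fun i => W.map (lpTranslate (T.equivFin.symm i : Γ)))
      (T.equivFin ⟨γ, hγ⟩)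
  have hdim : 0 < (Module.finrank ℂ W : ℝ) := by
    have := Submodule.one_le_finrank_iff.2 hW
    exact_mod_cast this
  set d : ℝ := (Module.finrank ℂ W : ℝ)
  have hWU (δ : Γ) : projectionDiagonal W δ ≤ projectionDiagonal U δ := by
    simpa [projectionDiagonal_map_lpTranslate] using
      projectionDiagonal_mono (hle (Finset.mem_insert_self 1 _)) δ
  have hsumW : HasSum (projectionDiagonal W) d := hasSum_projectionDiagonal W
  have hsumU := hasSum_projectionDiagonal U
  refine ⟨fun δ => projectionDiagonal W δ / d,
    fun δ => div_nonneg (projectionDiagonal_nonneg W δ) hdim.le, ?_, fun γ hγ => ?_⟩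
  · simpa [div_self hdim.ne'] using hsumW.div_const d
  have hshift : HasSum (fun δ => projectionDiagonal W (γ * δ)) d :=
    (Equiv.mulLeft γ).hasSum_iff.2 hsumW
  have hγU (δ : Γ) : projectionDiagonal W (γ * δ) ≤ projectionDiagonal U δ := by
    simpa [projectionDiagonal_map_lpTranslate] using
      projectionDiagonal_mono (hle (Finset.mem_insert_of_mem (Finset.mem_image_of_mem _ hγ))) δ
  have hbound := ((hsumU.sub hshift).add (hsumU.sub hsumW)).div_const d
  have habs (δ : Γ) : |projectionDiagonal W (γ * δ) / d - projectionDiagonal W δ / d| ≤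
      (projectionDiagonal U δ - projectionDiagonal W (γ * δ) +
        (projectionDiagonal U δ - projectionDiagonal W δ)) / d := by
    rw [← sub_div, abs_div, abs_of_pos hdim]
    refine div_le_div_of_nonneg_right (abs_le.2 ⟨?_, ?_⟩) hdim.le <;>
      linarith [hWU δ, hγU δ]
  have hsummable :=
    ((hshift.summable.div_const d).sub (hsumW.summable.div_const d)).abs
  refine (hasSum_le habs hsummable.hasSum hbound).trans ?_
  rw [div_le_iff₀ hdim]
  linarith
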